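/- Set ρ_{d−N}(x) = ∏_{j=1}^N (x−c_j)^{d_j}. Then, for every integer n ≥ 2, the polynomial ρ_{d−N} divides each of the three polynomials Δ_{1,n} = B_{3,n} A_{2,n} − A_{3,n} B_{2,n}, Δ_{2,n} = B_{3,n} C_{2,n} − A_{3,n} D_{2,n}, and Δ_{3,n} = B_{2,n} C_{3,n} − A_{2,n} D_{3,n}; writing Δ_{1,n} = ρ_{d−N} φ_{1,n}, Δ_{2,n} = ρ_{d−N} φ_{2,n}, Δ_{3,n} = ρ_{d−N} φ_{3,n}, for n ≥ d+1 the quotients have degrees deg φ_{1,n} = d+N, deg φ_{2,n} = d+N+1 and deg φ_{3,n} = d+N+1. -/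

import Mathlib

open Polynomial MeasureTheory Finset

noncomputable section

/-- The `k`-th derivative of a real polynomial. -/
def iterDeriv (k : ℕ) (f : Polynomial ℝ) : Polynomial ℝ := Polynomial.derivative^[k] f

/-- The Jacobi measure `dμ^{α,β}(x) = (1-x)^α (1+x)^β dx` on `[-1,1]`. -/
def jacobiMeasure (α β : ℝ) : Measure ℝ :=
  (volume.restrict (Set.Icc (-1 : ℝ) 1)).withDensity
    fun x => ENNReal.ofReal ((1 - x) ^ α * (1 + x) ^ β)

/-- The Jacobi–Sobolev inner product
`⟨f,g⟩_S = ∫ f g dμ^{α,β} + ∑_{j=1}^N ∑_{k=0}^{d_j} λ_{j,k} f^{(k)}(c_j) g^{(k)}(c_j)`. -/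
def sobolevIP (α β : ℝ) {N : ℕ} (c : Fin N → ℝ) (dd : Fin N → ℕ)
    (lam : Fin N → ℕ → ℝ) (f g : Polynomial ℝ) : ℝ :=
  (∫ x, f.eval x * g.eval x ∂(jacobiMeasure α β)) +
    ∑ j : Fin N, ∑ k ∈ Finset.range (dd j + 1),
      lam j k * (iterDeriv k f).eval (c j) * (iterDeriv k g).eval (c j)

/-- The degree-`k` Taylor polynomial of `f` centred at `c`:
`Q_k(x,c;f) = ∑_{ν=0}^k f^{(ν)}(c)(x-c)^ν/ν!` (as a polynomial in `x`). -/
def taylorPoly (k : ℕ) (c : ℝ) (f : Polynomial ℝ) : Polynomial ℝ :=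
  ∑ ν ∈ Finset.range (k + 1),
    Polynomial.C ((iterDeriv ν f).eval c / Nat.factorial ν) * (X - Polynomial.C c) ^ ν

/-- `ρ(x) = ∏_{j=1}^N (x-c_j)^{d_j+1}`. -/
def rhoPoly {N : ℕ} (c : Fin N → ℝ) (dd : Fin N → ℕ) : Polynomial ℝ :=
  ∏ j : Fin N, (X - Polynomial.C (c j)) ^ (dd j + 1)

/-- `ρ_{j,k}(x) = ρ(x)/(x-c_j)^{k+1} = (x-c_j)^{d_j-k} ∏_{i≠j} (x-c_i)^{d_i+1}`. -/
def rhoJK {N : ℕ} (c : Fin N → ℝ) (dd : Fin N → ℕ) (j : Fin N) (k : ℕ) : Polynomial ℝ :=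
  (X - Polynomial.C (c j)) ^ (dd j - k) *
    ∏ i ∈ Finset.univ.erase j, (X - Polynomial.C (c i)) ^ (dd i + 1)

/-- `â_n(x) = -n((2n+α+β)x+β-α)/(2n+α+β)`. -/
def ahat (α β : ℝ) (n : ℕ) : Polynomial ℝ :=
  Polynomial.C (-(n : ℝ) / (2 * (n : ℝ) + α + β)) *
    (Polynomial.C (2 * (n : ℝ) + α + β) * X + Polynomial.C (β - α))

/-- `b̂_n = 4n(n+α)(n+β)(n+α+β)/((2n+α+β)²(2n+α+β-1))`. -/
def bhat (α β : ℝ) (n : ℕ) : ℝ :=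
  4 * (n : ℝ) * ((n : ℝ) + α) * ((n : ℝ) + β) * ((n : ℝ) + α + β) /
    ((2 * (n : ℝ) + α + β) ^ 2 * (2 * (n : ℝ) + α + β - 1))

/-- `ĉ_n(x) = (n+α+β)((2n+α+β)x+α-β)/(2n+α+β)`. -/
def chat (α β : ℝ) (n : ℕ) : Polynomial ℝ :=
  Polynomial.C (((n : ℝ) + α + β) / (2 * (n : ℝ) + α + β)) *
    (Polynomial.C (2 * (n : ℝ) + α + β) * X + Polynomial.C (α - β))

/-- `d̂_n = -(2n+α+β-1)`. -/
def dhat (α β : ℝ) (n : ℕ) : ℝ := -(2 * (n : ℝ) + α + β - 1)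

/-- `γ_{1,n} = (β²-α²)/((2n+α+β)(2n+α+β+2))`. -/
def gamma1 (α β : ℝ) (n : ℕ) : ℝ :=
  (β ^ 2 - α ^ 2) / ((2 * (n : ℝ) + α + β) * (2 * (n : ℝ) + α + β + 2))

/-- `γ_{2,n} = 4n(n+α)(n+β)(n+α+β)/((2n+α+β)²((2n+α+β)²-1))`. -/
def gamma2 (α β : ℝ) (n : ℕ) : ℝ :=
  4 * (n : ℝ) * ((n : ℝ) + α) * ((n : ℝ) + β) * ((n : ℝ) + α + β) /
    ((2 * (n : ℝ) + α + β) ^ 2 * ((2 * (n : ℝ) + α + β) ^ 2 - 1))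

/-! ### The Jacobi measure -/

lemma jacobi_weight_nonneg (α β : ℝ) {x : ℝ} (hx : x ∈ Set.Icc (-1 : ℝ) 1) :
    0 ≤ (1 - x) ^ α * (1 + x) ^ β :=
  mul_nonneg (Real.rpow_nonneg (by linarith [hx.2]) _) (Real.rpow_nonneg (by linarith [hx.1]) _)

lemma jacobi_weight_intervalIntegrable {α β : ℝ} (hα : -1 < α) (hβ : -1 < β) :
    IntervalIntegrable (fun x : ℝ => (1 - x) ^ α * (1 + x) ^ β) volume (-1) 1 := by
  have hleft : IntervalIntegrable (fun x : ℝ => (1 - x) ^ α * (1 + x) ^ β) volume (-1) 0 := by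
    have hw : IntervalIntegrable (fun x : ℝ => (1 + x) ^ β) volume (-1) 0 := by
      have := (intervalIntegral.intervalIntegrable_rpow' (a := 0) (b := 1) hβ).comp_add_left 1
      norm_num at this
      exact this
    refine hw.continuousOn_mul (ContinuousOn.rpow_const (by fun_prop) fun x hx => Or.inl ?_)
    rw [Set.uIcc_of_le (by norm_num)] at hx
    linarith [hx.2]
  have hright : IntervalIntegrable (fun x : ℝ => (1 - x) ^ α * (1 + x) ^ β) volume 0 1 := by
    have hw : IntervalIntegrable (fun x : ℝ => (1 - x) ^ α) volume 0 1 := by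
      have := (intervalIntegral.intervalIntegrable_rpow' (a := 1) (b := 0) hα).comp_sub_left 1
      norm_num at this
      exact this
    refine hw.mul_continuousOn (ContinuousOn.rpow_const (by fun_prop) fun x hx => Or.inl ?_)
    rw [Set.uIcc_of_le (by norm_num)] at hx
    linarith [hx.1]
  exact hleft.trans hright

lemma measurable_jacobi_density (α β : ℝ) :
    Measurable fun x : ℝ => ENNReal.ofReal ((1 - x) ^ α * (1 + x) ^ β) :=
  ENNReal.measurable_ofReal.comp
    (((measurable_const.sub measurable_id).pow_const α).mul
      ((measurable_const.add measurable_id).pow_const β))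

lemma integrable_polynomial_jacobiMeasure {α β : ℝ} (hα : -1 < α) (hβ : -1 < β) (p : ℝ[X]) :
    Integrable (fun x => p.eval x) (jacobiMeasure α β) := by
  rw [jacobiMeasure, integrable_withDensity_iff_integrable_smul' (measurable_jacobi_density α β)
    (by simp)]
  have hint : IntegrableOn (fun x : ℝ => (1 - x) ^ α * (1 + x) ^ β * p.eval x)
      (Set.Icc (-1) 1) := by
    rw [← intervalIntegrable_iff_integrableOn_Icc_of_le (by norm_num)]
    exact (jacobi_weight_intervalIntegrable hα hβ).mul_continuousOn p.continuous.continuousOn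
  refine hint.congr_fun (fun x hx => ?_) measurableSet_Icc
  simp [ENNReal.toReal_ofReal (jacobi_weight_nonneg α β hx)]

lemma integral_jacobiMeasure (α β : ℝ) (f : ℝ → ℝ) :
    ∫ x, f x ∂(jacobiMeasure α β) =
      ∫ x in (-1 : ℝ)..1, (1 - x) ^ α * (1 + x) ^ β * f x := by
  rw [jacobiMeasure, integral_withDensity_eq_integral_toReal_smul (measurable_jacobi_density α β)
    (by simp), intervalIntegral.integral_of_le (by norm_num), ← integral_Icc_eq_integral_Ioc]
  refine setIntegral_congr_fun measurableSet_Icc fun x hx => ?_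
  simp [ENNReal.toReal_ofReal (jacobi_weight_nonneg α β hx)]

lemma integral_sq_pos_jacobiMeasure {α β : ℝ} (hα : -1 < α) (hβ : -1 < β) {p : ℝ[X]}
    (hp : p ≠ 0) : 0 < ∫ x, (p * p).eval x ∂(jacobiMeasure α β) := by
  rw [integral_pos_iff_support_of_nonneg (fun x => by simp [mul_self_nonneg])
    (integrable_polynomial_jacobiMeasure hα hβ _), pos_iff_ne_zero, jacobiMeasure, Ne,
    withDensity_apply_eq_zero (measurable_jacobi_density α β)]
  intro hzero
  have hsub : Set.Ioo (-1 : ℝ) 1 \ (p.roots.toFinset : Set ℝ) ⊆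
      ({x | ENNReal.ofReal ((1 - x) ^ α * (1 + x) ^ β) ≠ 0} ∩
        Function.support fun x => (p * p).eval x) ∩ Set.Icc (-1) 1 := by
    rintro x ⟨hx, hroot⟩
    refine ⟨⟨?_, ?_⟩, Set.Ioo_subset_Icc_self hx⟩
    · have : 0 < (1 - x) ^ α * (1 + x) ^ β :=
        mul_pos (Real.rpow_pos_of_pos (by linarith [hx.2]) _)
          (Real.rpow_pos_of_pos (by linarith [hx.1]) _)
      simpa using this
    · simpa [hp] using hroot
  have hnull : volume (Set.Ioo (-1 : ℝ) 1 \ (p.roots.toFinset : Set ℝ)) = 0 :=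
    measure_mono_null hsub (by rwa [Measure.restrict_apply' measurableSet_Icc] at hzero)
  rw [measure_sdiff_null (p.roots.toFinset.finite_toSet.measure_zero _), Real.volume_Ioo] at hnull
  norm_num at hnull

lemma integral_pearson_jacobiMeasure {α β : ℝ} (hα : -1 < α) (hβ : -1 < β) :
    ∫ x, (C (β - α) - C (α + β + 2) * X : ℝ[X]).eval x ∂(jacobiMeasure α β) = 0 := by
  rw [integral_jacobiMeasure]
  rw [intervalIntegral.integral_eq_sub_of_hasDerivAt_of_le
    (f := fun x : ℝ => (1 - x) ^ (α + 1) * (1 + x) ^ (β + 1)) (by norm_num)]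
  · have h1 : α + 1 ≠ 0 := by linarith
    have h2 : β + 1 ≠ 0 := by linarith
    norm_num [Real.zero_rpow h1, Real.zero_rpow h2]
  · refine ContinuousOn.mul (ContinuousOn.rpow_const (by fun_prop) fun x _ => Or.inr (by linarith))
      (ContinuousOn.rpow_const (by fun_prop) fun x _ => Or.inr (by linarith))
  · intro x hx
    have hx1 : 0 < 1 - x := by linarith [hx.2]
    have hx2 : 0 < 1 + x := by linarith [hx.1]
    have d1 := ((hasDerivAt_id x).const_sub 1).rpow_const (p := α + 1) (Or.inl hx1.ne')
    have d2 := ((hasDerivAt_id x).const_add 1).rpow_const (p := β + 1) (Or.inl hx2.ne')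
    refine (d1.mul d2).congr_deriv ?_
    simp only [id, add_sub_cancel_right, Real.rpow_add_one hx1.ne', Real.rpow_add_one hx2.ne',
      eval_sub, eval_mul, eval_C, eval_X]
    ring
  · exact (jacobi_weight_intervalIntegrable hα hβ).mul_continuousOn
      (Polynomial.continuous _).continuousOn

/-! ### Orthogonal polynomials with respect to a positive definite functional -/

/-- The functional sending a polynomial to the `k`-th coefficient of its expansion at `c`. -/
def taylorCoeff (k : ℕ) (c : ℝ) : ℝ[X] →ₗ[ℝ] ℝ where
  toFun f := (taylor c f).coeff k
  map_add' f g := by simp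
  map_smul' a f := by simp

lemma eval_iterDeriv (k : ℕ) (c : ℝ) (f : ℝ[X]) :
    (iterDeriv k f).eval c = k.factorial * taylorCoeff k c f := by
  change _ = (k.factorial : ℝ) * (taylor c f).coeff k
  rw [iterDeriv, taylor_coeff, ← factorial_smul_hasseDeriv]
  simp

lemma taylorCoeff_zero_X_mul (c : ℝ) (f : ℝ[X]) :
    taylorCoeff 0 c (X * f) = c * taylorCoeff 0 c f := by
  change (taylor c (X * f)).coeff 0 = c * (taylor c f).coeff 0
  simp [taylor_coeff_zero]

lemma taylorCoeff_succ_X_mul (k : ℕ) (c : ℝ) (f : ℝ[X]) :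
    taylorCoeff (k + 1) c (X * f) = c * taylorCoeff (k + 1) c f + taylorCoeff k c f := by
  change (taylor c (X * f)).coeff (k + 1) = c * (taylor c f).coeff (k + 1) + (taylor c f).coeff k
  rw [taylor_mul, taylor_X, add_mul, coeff_add, coeff_X_mul, coeff_C_mul]
  ring

lemma taylorPoly_eq (k : ℕ) (c : ℝ) (f : ℝ[X]) :
    taylorPoly k c f = ∑ ν ∈ range (k + 1), C (taylorCoeff ν c f) * (X - C c) ^ ν := by
  refine sum_congr rfl fun ν _ => ?_
  have : (ν.factorial : ℝ) ≠ 0 := Nat.cast_ne_zero.2 ν.factorial_ne_zero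
  rw [eval_iterDeriv, mul_div_cancel_left₀ _ this]

lemma exists_eq_sum_of_degree_lt {P : ℕ → ℝ[X]} (hPm : ∀ m, (P m).Monic)
    (hPd : ∀ m, (P m).natDegree = m) (n : ℕ) :
    ∀ f : ℝ[X], f.degree < n → ∃ a : ℕ → ℝ, f = ∑ m ∈ range n, C (a m) * P m := by
  induction n with
  | zero =>
    intro f hf
    refine ⟨0, ?_⟩
    simpa using hf
  | succ n ih =>
    intro f hf
    have hlt : (f - C (f.coeff n) * P n).degree < n := by
      rw [degree_lt_iff_coeff_zero]
      intro m hm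
      rcases hm.eq_or_lt with rfl | hm
      · have : (P n).coeff n = 1 := by
          have := hPm n
          rwa [Monic, leadingCoeff, hPd] at this
        simp [this]
      · have h1 : f.coeff m = 0 := (degree_lt_iff_coeff_zero _ _).1 hf m hm
        have h2 : (P n).coeff m = 0 := coeff_eq_zero_of_natDegree_lt (by rwa [hPd])
        simp [h1, h2]
    obtain ⟨a, ha⟩ := ih _ hlt
    refine ⟨fun m => if m = n then f.coeff n else a m, ?_⟩
    simp only [sum_range_succ, if_true]
    have : ∑ m ∈ range n, C (if m = n then f.coeff n else a m) * P m =
        ∑ m ∈ range n, C (a m) * P m :=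
      sum_congr rfl fun m hm => by rw [if_neg (mem_range.1 hm).ne]
    rw [this, ← ha, sub_add_cancel]

lemma map_C_mul (L : ℝ[X] →ₗ[ℝ] ℝ) (a : ℝ) (p : ℝ[X]) : L (C a * p) = a * L p := by
  rw [← smul_eq_C_mul, map_smul, smul_eq_mul]

lemma map_mul_eq_zero_of_degree_lt {L : ℝ[X] →ₗ[ℝ] ℝ} {P : ℕ → ℝ[X]}
    (hPm : ∀ m, (P m).Monic) (hPd : ∀ m, (P m).natDegree = m)
    (hPo : ∀ m l, m ≠ l → L (P m * P l) = 0) {n : ℕ} {f : ℝ[X]} (hf : f.degree < n) :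
    L (f * P n) = 0 := by
  obtain ⟨a, rfl⟩ := exists_eq_sum_of_degree_lt hPm hPd n f hf
  rw [sum_mul, map_sum]
  refine sum_eq_zero fun m hm => ?_
  rw [mul_assoc, map_C_mul, hPo _ _ (mem_range.1 hm).ne, mul_zero]

lemma eq_sum_of_degree_lt {L : ℝ[X] →ₗ[ℝ] ℝ} (hL : ∀ p : ℝ[X], p ≠ 0 → 0 < L (p * p))
    {P : ℕ → ℝ[X]} (hPm : ∀ m, (P m).Monic) (hPd : ∀ m, (P m).natDegree = m)
    (hPo : ∀ m l, m ≠ l → L (P m * P l) = 0) {n : ℕ} {f : ℝ[X]} (hf : f.degree < n) :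
    f = ∑ m ∈ range n, C (L (f * P m) / L (P m * P m)) * P m := by
  obtain ⟨a, ha⟩ := exists_eq_sum_of_degree_lt hPm hPd n f hf
  have key : ∀ m ∈ range n, L (f * P m) = a m * L (P m * P m) := by
    intro m hm
    rw [ha, sum_mul, map_sum, sum_eq_single_of_mem m hm]
    · rw [mul_assoc, map_C_mul]
    · intro l _ hl
      rw [mul_assoc, map_C_mul, hPo _ _ hl, mul_zero]
  conv_lhs => rw [ha]
  refine sum_congr rfl fun m hm => ?_
  rw [key m hm, mul_div_cancel_right₀ _ (hL _ (hPm m).ne_zero).ne']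

lemma degree_sub_lt_of_monic {p q : ℝ[X]} {n : ℕ} (hp : p.Monic) (hq : q.Monic)
    (hpd : p.natDegree = n) (hqd : q.natDegree = n) : (p - q).degree < n := by
  rw [degree_lt_iff_coeff_zero]
  intro m hm
  have hp' : p.coeff n = 1 := by rwa [Monic, leadingCoeff, hpd] at hp
  have hq' : q.coeff n = 1 := by rwa [Monic, leadingCoeff, hqd] at hq
  rcases hm.eq_or_lt with rfl | hm
  · simp [hp', hq']
  · simp [coeff_eq_zero_of_natDegree_lt (hpd.trans_lt hm),
      coeff_eq_zero_of_natDegree_lt (hqd.trans_lt hm)]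

/-- The coefficient `γ₂` of a three-term recurrence is the ratio of consecutive norms. -/
lemma recurrence_coeff_mul_norm {L : ℝ[X] →ₗ[ℝ] ℝ} {P : ℕ → ℝ[X]}
    (hPm : ∀ m, (P m).Monic) (hPd : ∀ m, (P m).natDegree = m)
    (hPo : ∀ m l, m ≠ l → L (P m * P l) = 0) {g₁ g₂ : ℕ → ℝ}
    (hrec : ∀ m, 1 ≤ m → X * P m = P (m + 1) + C (g₁ m) * P m + C (g₂ m) * P (m - 1))
    (m : ℕ) : g₂ (m + 1) * L (P m * P m) = L (P (m + 1) * P (m + 1)) := by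
  have h1 : L (X * P (m + 1) * P m) = g₂ (m + 1) * L (P m * P m) := by
    rw [hrec (m + 1) (by lia), Nat.add_sub_cancel, add_mul, add_mul, map_add, map_add, mul_assoc,
      mul_assoc, map_C_mul, map_C_mul, hPo _ _ (by lia), hPo _ _ (by lia)]
    simp
  have h2 : L ((X * P m - P (m + 1)) * P (m + 1)) = 0 := by
    refine map_mul_eq_zero_of_degree_lt hPm hPd hPo ?_
    refine degree_sub_lt_of_monic (monic_X.mul (hPm m)) (hPm _) ?_ (hPd _)
    rw [monic_X.natDegree_mul (hPm m), natDegree_X, hPd, add_comm]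
  rw [sub_mul, map_sub, sub_eq_zero] at h2
  rw [← h1, ← h2]
  congr 1
  ring

lemma isCoprime_of_recurrence {P : ℕ → ℝ[X]} (hP0 : P 0 = 1) {g₁ g₂ : ℕ → ℝ}
    (hg₂ : ∀ m, 1 ≤ m → g₂ m ≠ 0)
    (hrec : ∀ m, 1 ≤ m → X * P m = P (m + 1) + C (g₁ m) * P m + C (g₂ m) * P (m - 1)) (m : ℕ) :
    IsCoprime (P (m + 1)) (P m) := by
  induction m with
  | zero => rw [hP0]; exact isCoprime_one_right
  | succ m ih =>
    have hr := hrec (m + 1) (by lia)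
    rw [Nat.add_sub_cancel] at hr
    have heq : P (m + 1 + 1) = -(C (g₂ (m + 1)) * P m) + (X - C (g₁ (m + 1))) * P (m + 1) := by
      linear_combination -hr
    have hu : IsUnit (C (g₂ (m + 1))) := isUnit_C.2 (hg₂ _ (by lia)).isUnit
    rw [heq, IsCoprime.add_mul_right_left_iff, IsCoprime.neg_left_iff,
      isCoprime_mul_unit_left_left hu]
    exact ih.symm

lemma christoffel_darboux_functional {L : ℝ[X] →ₗ[ℝ] ℝ}
    (hL : ∀ p : ℝ[X], p ≠ 0 → 0 < L (p * p)) {P : ℕ → ℝ[X]}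
    (hPm : ∀ m, (P m).Monic) (hPd : ∀ m, (P m).natDegree = m)
    (hPo : ∀ m l, m ≠ l → L (P m * P l) = 0) {g₁ g₂ : ℕ → ℝ}
    (hrec : ∀ m, 1 ≤ m → X * P m = P (m + 1) + C (g₁ m) * P m + C (g₂ m) * P (m - 1))
    (ℓ : ℝ[X] →ₗ[ℝ] ℝ) (n : ℕ) :
    ∑ m ∈ range (n + 1), C (1 / L (P m * P m)) *
        (C (ℓ (P m)) * (X * P m) - C (ℓ (X * P m)) * P m) =
      C (1 / L (P n * P n)) * (C (ℓ (P n)) * P (n + 1) - C (ℓ (P (n + 1))) * P n) := by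
  induction n with
  | zero =>
    have hlt : (X * P 0 - P 1).degree < ((1 : ℕ) : WithBot ℕ) := by
      refine degree_sub_lt_of_monic (monic_X.mul (hPm 0)) (hPm _) ?_ (hPd _)
      rw [monic_X.natDegree_mul (hPm 0), natDegree_X, hPd]
    obtain ⟨a, ha⟩ := exists_eq_sum_of_degree_lt hPm hPd 1 _ hlt
    rw [sum_range_one, sub_eq_iff_eq_add] at ha
    rw [sum_range_one, ha, map_add, map_C_mul, C_add, C_mul]
    ring
  | succ n ih =>
    have h1 := (hL _ (hPm n).ne_zero).ne'
    have h2 := (hL _ (hPm (n + 1)).ne_zero).ne'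
    have hg := recurrence_coeff_mul_norm hPm hPd hPo hrec n
    have hC : C (1 / L (P n * P n)) = C (1 / L (P (n + 1) * P (n + 1))) * C (g₂ (n + 1)) := by
      rw [← C_mul]
      congr 1
      field_simp
      linarith
    rw [sum_range_succ, ih, hrec (n + 1) (by lia), Nat.add_sub_cancel, map_add ℓ,
      map_add ℓ, map_C_mul, map_C_mul, C_add, C_add, C_mul, C_mul, hC]
    ring

/-- The Christoffel–Darboux formula for the derivatives of the kernel in the second variable. -/
lemma christoffel_darboux_taylor {L : ℝ[X] →ₗ[ℝ] ℝ}
    (hL : ∀ p : ℝ[X], p ≠ 0 → 0 < L (p * p)) {P : ℕ → ℝ[X]}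
    (hPm : ∀ m, (P m).Monic) (hPd : ∀ m, (P m).natDegree = m)
    (hPo : ∀ m l, m ≠ l → L (P m * P l) = 0) {g₁ g₂ : ℕ → ℝ}
    (hrec : ∀ m, 1 ≤ m → X * P m = P (m + 1) + C (g₁ m) * P m + C (g₂ m) * P (m - 1))
    (c : ℝ) (n k : ℕ) :
    (X - C c) ^ (k + 1) *
        ∑ m ∈ range (n + 1), C (taylorCoeff k c (P m) / L (P m * P m)) * P m =
      C (1 / L (P n * P n)) *
        (taylorPoly k c (P n) * P (n + 1) - taylorPoly k c (P (n + 1)) * P n) := by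
  induction k with
  | zero =>
    have hcd := christoffel_darboux_functional hL hPm hPd hPo hrec (taylorCoeff 0 c) n
    simp only [taylorPoly_eq, zero_add, sum_range_one, pow_zero, mul_one, pow_one]
    rw [← hcd, mul_sum]
    refine sum_congr rfl fun m _ => ?_
    rw [taylorCoeff_zero_X_mul, div_eq_mul_one_div, C_mul, C_mul]
    ring
  | succ k ih =>
    have hcd := christoffel_darboux_functional hL hPm hPd hPo hrec (taylorCoeff (k + 1) c) n
    have hstep : (X - C c) *
          ∑ m ∈ range (n + 1), C (taylorCoeff (k + 1) c (P m) / L (P m * P m)) * P m =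
        ∑ m ∈ range (n + 1), C (taylorCoeff k c (P m) / L (P m * P m)) * P m +
        C (1 / L (P n * P n)) * (C (taylorCoeff (k + 1) c (P n)) * P (n + 1) -
          C (taylorCoeff (k + 1) c (P (n + 1))) * P n) := by
      rw [← hcd, mul_sum, ← sum_add_distrib]
      refine sum_congr rfl fun m _ => ?_
      rw [taylorCoeff_succ_X_mul, div_eq_mul_one_div, div_eq_mul_one_div (taylorCoeff k c (P m)),
        C_mul, C_mul, C_add, C_mul]
      ring
    rw [pow_succ, mul_assoc, hstep, mul_add, ih]
    simp only [taylorPoly_eq]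
    rw [sum_range_succ _ (k + 1), sum_range_succ _ (k + 1)]
    ring

/-! ### The structure relations for monic Jacobi polynomials -/

section StructureRelations

variable {α β : ℝ}

lemma two_mul_add_pos (hα : -1 < α) (hβ : -1 < β) {n : ℕ} (hn : 1 ≤ n) :
    0 < 2 * (n : ℝ) + α + β := by
  have : (1 : ℝ) ≤ n := by exact_mod_cast hn
  linarith

lemma two_mul_add_sub_one_ne_zero (hα : -1 < α) (hβ : -1 < β) (hs : 1 + α + β ≠ 0) {n : ℕ}
    (hn : 1 ≤ n) : 2 * (n : ℝ) + α + β - 1 ≠ 0 := by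
  rcases hn.eq_or_lt with rfl | hn
  · intro h0
    apply hs
    push_cast at h0
    linarith
  · have : (2 : ℝ) ≤ n := by exact_mod_cast hn
    linarith

lemma bhat_eq_mul_gamma2 (hα : -1 < α) (hβ : -1 < β) (hs : 1 + α + β ≠ 0) {n : ℕ} (hn : 1 ≤ n) :
    bhat α β n = (2 * (n : ℝ) + α + β + 1) * gamma2 α β n := by
  have h0 := two_mul_add_pos hα hβ hn
  have h1 := two_mul_add_sub_one_ne_zero hα hβ hs hn
  have h2 : 2 * (n : ℝ) + α + β + 1 ≠ 0 := by linarith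
  have h3 : (2 * (n : ℝ) + α + β) ^ 2 - 1 =
      (2 * (n : ℝ) + α + β - 1) * (2 * (n : ℝ) + α + β + 1) := by ring
  rw [bhat, gamma2, h3]
  have h0 := h0.ne'
  generalize 2 * (n : ℝ) + α + β = t at *
  field_simp

lemma chat_succ (hα : -1 < α) (hβ : -1 < β) {n : ℕ} (hn : 1 ≤ n) :
    chat α β (n + 1) =
      ahat α β n + C (2 * (n : ℝ) + α + β + 1) * (X - C (gamma1 α β n)) := by
  have h0 := two_mul_add_pos hα hβ hn
  have h1 : 2 * ((n : ℝ) + 1) + α + β = 2 * (n : ℝ) + α + β + 2 := by ring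
  have h2 : 2 * (n : ℝ) + α + β + 2 ≠ 0 := by linarith
  have h0 := h0.ne'
  refine Polynomial.funext fun x => ?_
  simp only [chat, ahat, gamma1, eval_add, eval_sub, eval_mul, eval_C, eval_X, Nat.cast_add,
    Nat.cast_one, h1]
  generalize ht : 2 * (n : ℝ) + α + β = t at *
  field_simp
  obtain rfl : β = t - 2 * n - α := by linarith
  ring

lemma chat_eq_ahat_succ (hα : -1 < α) (hβ : -1 < β) {n : ℕ} (hn : 1 ≤ n) :
    chat α β n =
      ahat α β (n + 1) + C (2 * (n : ℝ) + α + β + 1) * (X - C (gamma1 α β n)) := by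
  have h0 := two_mul_add_pos hα hβ hn
  have h1 : 2 * ((n : ℝ) + 1) + α + β = 2 * (n : ℝ) + α + β + 2 := by ring
  have h2 : 2 * (n : ℝ) + α + β + 2 ≠ 0 := by linarith
  have h0 := h0.ne'
  refine Polynomial.funext fun x => ?_
  simp only [chat, ahat, gamma1, eval_add, eval_sub, eval_mul, eval_C, eval_X, Nat.cast_add,
    Nat.cast_one, h1]
  generalize ht : 2 * (n : ℝ) + α + β = t at *
  field_simp
  obtain rfl : β = t - 2 * n - α := by linarith
  ring

lemma ahat_bhat_recurrence (hα : -1 < α) (hβ : -1 < β) (hs : 1 + α + β ≠ 0) {n : ℕ}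
    (hn : 1 ≤ n) :
    1 - X ^ 2 + (X - C (gamma1 α β n)) * ahat α β n - C (gamma2 α β n) * C (dhat α β n) =
      ahat α β (n + 1) * (X - C (gamma1 α β n)) + C (bhat α β (n + 1)) := by
  have h0 := two_mul_add_pos hα hβ hn
  have h1 : 2 * ((n : ℝ) + 1) + α + β = 2 * (n : ℝ) + α + β + 2 := by ring
  have h2 : 2 * (n : ℝ) + α + β + 2 ≠ 0 := by linarith
  have h3 := two_mul_add_sub_one_ne_zero hα hβ hs hn
  have h4 : 2 * (n : ℝ) + α + β + 1 ≠ 0 := by linarith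
  have h5 : 2 * (n : ℝ) + α + β + 2 - 1 = 2 * (n : ℝ) + α + β + 1 := by ring
  have h6 : (2 * (n : ℝ) + α + β) ^ 2 - 1 =
      (2 * (n : ℝ) + α + β - 1) * (2 * (n : ℝ) + α + β + 1) := by ring
  have h0 := h0.ne'
  refine Polynomial.funext fun x => ?_
  simp only [ahat, bhat, dhat, gamma1, gamma2, eval_add, eval_sub, eval_mul, eval_C, eval_X,
    eval_pow, eval_one, Nat.cast_add, Nat.cast_one, h1, h5, h6]
  generalize ht : 2 * (n : ℝ) + α + β = t at *
  field_simp
  obtain rfl : β = t - 2 * n - α := by linarith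
  ring

lemma jacobi_structure {P : ℕ → ℝ[X]} (hα : -1 < α) (hβ : -1 < β) (hs : 1 + α + β ≠ 0)
    (hP0 : P 0 = 1) (hP1 : P 1 = X - C ((β - α) / (α + β + 2)))
    (hrec : ∀ m, 1 ≤ m → X * P m =
      P (m + 1) + C (gamma1 α β m) * P m + C (gamma2 α β m) * P (m - 1)) (m : ℕ) :
    (1 - X ^ 2) * derivative (P (m + 1)) =
        ahat α β (m + 1) * P (m + 1) + C (bhat α β (m + 1)) * P m ∧
      (1 - X ^ 2) * derivative (P m) =
        chat α β (m + 1) * P m + C (dhat α β (m + 1)) * P (m + 1) := by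
  induction m with
  | zero =>
    have h2 : α + β + 2 ≠ 0 := by linarith
    have h3 : 2 * (1 : ℝ) + α + β = α + β + 2 := by ring
    have h4 : α + β + 2 - 1 = 1 + α + β := by ring
    rw [zero_add, hP0, hP1]
    constructor
    · refine Polynomial.funext fun x => ?_
      simp only [ahat, bhat, derivative_sub, derivative_X, derivative_C, eval_add, eval_sub,
        eval_mul, eval_C, eval_X, eval_pow, eval_one, eval_zero, Nat.cast_one, h3, h4]
      field_simp
      ring
    · refine Polynomial.funext fun x => ?_
      simp only [chat, dhat, derivative_one, eval_add, eval_sub, eval_mul, eval_C, eval_X,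
        eval_pow, eval_one, eval_zero, Nat.cast_one, h3, h4]
      field_simp
      ring
  | succ m ih =>
    obtain ⟨ih1, ih2⟩ := ih
    have hm : 1 ≤ m + 1 := by lia
    have hr := hrec (m + 1) hm
    rw [Nat.add_sub_cancel] at hr
    have hP : P (m + 1 + 1) =
        (X - C (gamma1 α β (m + 1))) * P (m + 1) - C (gamma2 α β (m + 1)) * P m := by
      linear_combination -hr
    have hb := congrArg C (bhat_eq_mul_gamma2 hα hβ hs hm)
    rw [C_mul] at hb
    constructor
    · have hD : derivative (P (m + 1 + 1)) = P (m + 1) +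
          (X - C (gamma1 α β (m + 1))) * derivative (P (m + 1)) -
            C (gamma2 α β (m + 1)) * derivative (P m) := by
        rw [hP]
        simp
      have e1 := ahat_bhat_recurrence hα hβ hs hm
      have e2 := chat_eq_ahat_succ hα hβ hm
      rw [hD, hP]
      linear_combination (X - C (gamma1 α β (m + 1))) * ih1 - C (gamma2 α β (m + 1)) * ih2 +
        P (m + 1) * e1 - C (gamma2 α β (m + 1)) * P m * e2 +
        (X - C (gamma1 α β (m + 1))) * P m * hb
    · have hd : C (dhat α β (m + 1 + 1)) = -C (2 * ((m + 1 : ℕ) : ℝ) + α + β + 1) := by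
        rw [← C_neg, dhat]
        congr 1
        push_cast
        ring
      rw [ih1, chat_succ hα hβ hm, hd, hP, hb]
      ring

end StructureRelations

/-! ### Connection with the Sobolev orthogonal polynomials -/

/-- Integration against the Jacobi measure as a linear functional on polynomials. -/
def jacobiFunctional {α β : ℝ} (hα : -1 < α) (hβ : -1 < β) : ℝ[X] →ₗ[ℝ] ℝ where
  toFun p := ∫ x, p.eval x ∂(jacobiMeasure α β)
  map_add' p q := by
    simp only [eval_add]
    exact integral_add (integrable_polynomial_jacobiMeasure hα hβ p)
      (integrable_polynomial_jacobiMeasure hα hβ q)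
  map_smul' a p := by
    simp only [eval_smul, smul_eq_mul, RingHom.id_apply]
    exact integral_const_mul a _

/-- The linear functional `f ↦ ⟨f, g⟩_S`. -/
def sobolevFunctional (L : ℝ[X] →ₗ[ℝ] ℝ) {N : ℕ} (c : Fin N → ℝ) (dd : Fin N → ℕ)
    (lam : Fin N → ℕ → ℝ) (g : ℝ[X]) : ℝ[X] →ₗ[ℝ] ℝ :=
  L ∘ₗ LinearMap.mulRight ℝ g + ∑ j : Fin N, ∑ k ∈ range (dd j + 1),
    (k.factorial * lam j k * (iterDeriv k g).eval (c j)) • taylorCoeff k (c j)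

lemma sobolevFunctional_apply (L : ℝ[X] →ₗ[ℝ] ℝ) {N : ℕ} (c : Fin N → ℝ) (dd : Fin N → ℕ)
    (lam : Fin N → ℕ → ℝ) (f g : ℝ[X]) :
    sobolevFunctional L c dd lam g f = L (f * g) + ∑ j : Fin N, ∑ k ∈ range (dd j + 1),
      k.factorial * lam j k * (iterDeriv k g).eval (c j) * taylorCoeff k (c j) f := by
  simp [sobolevFunctional, LinearMap.sum_apply]

lemma sobolevIP_eq {α β : ℝ} (hα : -1 < α) (hβ : -1 < β) {N : ℕ} (c : Fin N → ℝ)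
    (dd : Fin N → ℕ) (lam : Fin N → ℕ → ℝ) (f g : ℝ[X]) :
    sobolevIP α β c dd lam f g = sobolevFunctional (jacobiFunctional hα hβ) c dd lam g f := by
  rw [sobolevFunctional_apply, sobolevIP]
  congr 1
  · simp [jacobiFunctional]
  · refine sum_congr rfl fun j _ => sum_congr rfl fun k _ => ?_
    rw [eval_iterDeriv k (c j) f]
    ring

section Sobolev

variable {L : ℝ[X] →ₗ[ℝ] ℝ} {N : ℕ} {c : Fin N → ℝ} {dd : Fin N → ℕ} {lam : Fin N → ℕ → ℝ}

lemma sobolevFunctional_eq_zero_of_degree_lt {g : ℝ[X]} {n : ℕ}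
    (hg : ∀ l < n, sobolevFunctional L c dd lam g (X ^ l) = 0) {f : ℝ[X]} (hf : f.degree < n) :
    sobolevFunctional L c dd lam g f = 0 := by
  obtain ⟨a, rfl⟩ := exists_eq_sum_of_degree_lt (P := fun m => X ^ m) (fun m => monic_X_pow m)
    (fun m => natDegree_X_pow m) n f hf
  rw [map_sum]
  refine sum_eq_zero fun m hm => ?_
  rw [map_C_mul, hg m (mem_range.1 hm), mul_zero]

/-- The discrete part of `⟨P_n, S_n⟩_S` is nonnegative. -/
lemma sobolev_discrete_nonneg (hL : ∀ p : ℝ[X], p ≠ 0 → 0 < L (p * p)) {P S : ℕ → ℝ[X]}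
    (hPm : ∀ m, (P m).Monic) (hPd : ∀ m, (P m).natDegree = m)
    (hPo : ∀ m l, m ≠ l → L (P m * P l) = 0)
    (hSm : ∀ m, (S m).Monic) (hSd : ∀ m, (S m).natDegree = m)
    (hSo : ∀ m l, l < m → sobolevFunctional L c dd lam (S m) (X ^ l) = 0)
    (hlam : ∀ j k, 0 ≤ lam j k) (n : ℕ) :
    0 ≤ ∑ j : Fin N, ∑ k ∈ range (dd j + 1),
      k.factorial * lam j k * (iterDeriv k (S n)).eval (c j) * taylorCoeff k (c j) (P n) := by
  have hlt := degree_sub_lt_of_monic (hSm n) (hPm n) (hSd n) (hPd n)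
  have h1 : sobolevFunctional L c dd lam (S n) (S n - P n) = 0 :=
    sobolevFunctional_eq_zero_of_degree_lt (hSo n) hlt
  have h2 : L ((S n - P n) * P n) = 0 := map_mul_eq_zero_of_degree_lt hPm hPd hPo hlt
  have h3 : 0 ≤ L ((S n - P n) * (S n - P n)) := by
    by_cases h0 : S n - P n = 0
    · simp [h0]
    · exact (hL _ h0).le
  have h4 : 0 ≤ ∑ j : Fin N, ∑ k ∈ range (dd j + 1),
      k.factorial * lam j k * (iterDeriv k (S n)).eval (c j) * taylorCoeff k (c j) (S n) := by
    refine sum_nonneg fun j _ => sum_nonneg fun k _ => ?_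
    rw [eval_iterDeriv]
    have := mul_nonneg (hlam j k) (mul_self_nonneg (k.factorial * taylorCoeff k (c j) (S n)))
    linarith
  rw [map_sub, sobolevFunctional_apply, sobolevFunctional_apply] at h1
  have h5 : L ((S n - P n) * (S n - P n)) = L (S n * S n) - L (P n * S n) -
      L ((S n - P n) * P n) := by
    rw [← map_sub, ← map_sub]
    congr 1
    ring
  linarith

lemma sobolev_eq_sub_sum (hL : ∀ p : ℝ[X], p ≠ 0 → 0 < L (p * p)) {P S : ℕ → ℝ[X]}
    (hPm : ∀ m, (P m).Monic) (hPd : ∀ m, (P m).natDegree = m)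
    (hPo : ∀ m l, m ≠ l → L (P m * P l) = 0)
    (hSm : ∀ m, (S m).Monic) (hSd : ∀ m, (S m).natDegree = m)
    (hSo : ∀ m l, l < m → sobolevFunctional L c dd lam (S m) (X ^ l) = 0) (n : ℕ) :
    S n = P n - ∑ j : Fin N, ∑ k ∈ range (dd j + 1),
      C (k.factorial * lam j k * (iterDeriv k (S n)).eval (c j)) *
        ∑ m ∈ range n, C (taylorCoeff k (c j) (P m) / L (P m * P m)) * P m := by
  have hlt := degree_sub_lt_of_monic (hSm n) (hPm n) (hSd n) (hPd n)
  have hcoeff : ∀ m ∈ range n, L ((S n - P n) * P m) = -∑ j : Fin N, ∑ k ∈ range (dd j + 1),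
      k.factorial * lam j k * (iterDeriv k (S n)).eval (c j) * taylorCoeff k (c j) (P m) := by
    intro m hm
    have hmn := mem_range.1 hm
    have hPm_lt : (P m).degree < n := by
      rw [degree_eq_natDegree (hPm m).ne_zero, hPd]
      exact_mod_cast hmn
    have h1 : sobolevFunctional L c dd lam (S n) (P m) = 0 :=
      sobolevFunctional_eq_zero_of_degree_lt (hSo n) hPm_lt
    rw [sobolevFunctional_apply] at h1
    rw [sub_mul, map_sub, hPo n m hmn.ne', mul_comm (S n)]
    linarith
  rw [sub_eq_add_neg, ← sub_eq_iff_eq_add']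
  refine (eq_sum_of_degree_lt hL hPm hPd hPo hlt).trans ?_
  simp_rw [mul_sum]
  rw [sum_congr rfl fun j _ => sum_comm, sum_comm, ← sum_neg_distrib]
  refine sum_congr rfl fun m hm => ?_
  rw [hcoeff m hm, neg_div, C_neg, neg_mul, sum_div, map_sum, sum_mul]
  congr 1
  refine sum_congr rfl fun j _ => ?_
  rw [sum_div, map_sum, sum_mul]
  refine sum_congr rfl fun k _ => ?_
  rw [← mul_assoc, ← C_mul, mul_div_assoc]

lemma rhoPoly_eq_rhoJK_mul (j : Fin N) {k : ℕ} (hk : k ≤ dd j) :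
    rhoPoly c dd = rhoJK c dd j k * (X - C (c j)) ^ (k + 1) := by
  rw [rhoPoly, rhoJK, ← mul_prod_erase univ _ (mem_univ j),
    show dd j + 1 = (dd j - k) + (k + 1) by lia, pow_add]
  ring

/-- The connection formula `ρ S_n = A_{2,n} P_n + B_{2,n} P_{n-1}`. -/
lemma rho_mul_sobolev (hL : ∀ p : ℝ[X], p ≠ 0 → 0 < L (p * p)) {P S : ℕ → ℝ[X]}
    (hPm : ∀ m, (P m).Monic) (hPd : ∀ m, (P m).natDegree = m)
    (hPo : ∀ m l, m ≠ l → L (P m * P l) = 0)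
    (hSm : ∀ m, (S m).Monic) (hSd : ∀ m, (S m).natDegree = m)
    (hSo : ∀ m l, l < m → sobolevFunctional L c dd lam (S m) (X ^ l) = 0) {g₁ g₂ : ℕ → ℝ}
    (hrec : ∀ m, 1 ≤ m → X * P m = P (m + 1) + C (g₁ m) * P m + C (g₂ m) * P (m - 1))
    (n : ℕ) :
    rhoPoly c dd * S (n + 1) =
      (rhoPoly c dd - ∑ j : Fin N, ∑ k ∈ range (dd j + 1),
        C (k.factorial * lam j k * (iterDeriv k (S (n + 1))).eval (c j) / L (P n * P n)) *
          (taylorPoly k (c j) (P n) * rhoJK c dd j k)) * P (n + 1) +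
      (∑ j : Fin N, ∑ k ∈ range (dd j + 1),
        C (k.factorial * lam j k * (iterDeriv k (S (n + 1))).eval (c j) / L (P n * P n)) *
          (taylorPoly k (c j) (P (n + 1)) * rhoJK c dd j k)) * P n := by
  have hS := sobolev_eq_sub_sum hL hPm hPd hPo hSm hSd hSo (n + 1)
  conv_lhs => rw [hS]
  rw [mul_sub, sub_mul, sub_add, sub_right_inj, sum_mul, sum_mul, mul_sum,
    ← sum_sub_distrib]
  refine sum_congr rfl fun j _ => ?_
  rw [sum_mul, sum_mul, mul_sum, ← sum_sub_distrib]
  refine sum_congr rfl fun k hk => ?_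
  have hcd := christoffel_darboux_taylor hL hPm hPd hPo hrec (c j) n k
  rw [rhoPoly_eq_rhoJK_mul j (Nat.lt_succ_iff.1 (mem_range.1 hk)),
    div_eq_mul_one_div _ (L (P n * P n))]
  generalize (k.factorial : ℝ) * lam j k * (iterDeriv k (S (n + 1))).eval (c j) = w
  rw [C_mul]
  linear_combination rhoJK c dd j k * C w * hcd

lemma prod_pow_dvd_rhoPoly (c : Fin N → ℝ) (dd : Fin N → ℕ) :
    (∏ j : Fin N, (X - C (c j)) ^ dd j) ∣ rhoPoly c dd := by
  rw [rhoPoly]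
  exact prod_dvd_prod_of_dvd _ _ fun j _ => pow_dvd_pow _ (Nat.le_succ (dd j))

lemma prod_pow_dvd_derivative_prod {ι : Type*} (s : Finset ι) (c : ι → ℝ) (dd : ι → ℕ) :
    (∏ j ∈ s, (X - C (c j)) ^ dd j) ∣ derivative (∏ j ∈ s, (X - C (c j)) ^ (dd j + 1)) := by
  classical
  induction s using Finset.induction_on with
  | empty => simp
  | insert i s hi ih =>
    rw [prod_insert hi, prod_insert hi, derivative_mul]
    refine dvd_add (mul_dvd_mul ?_ ?_) (mul_dvd_mul (pow_dvd_pow _ (Nat.le_succ _)) ih)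
    · rw [derivative_X_sub_C_pow, Nat.add_sub_cancel]
      exact Dvd.intro_left _ rfl
    · exact prod_dvd_prod_of_dvd _ _ fun j _ => pow_dvd_pow _ (Nat.le_succ (dd j))

end Sobolev

lemma dvd_det_of_isCoprime {G p q A B A' B' : ℝ[X]} (hpq : IsCoprime p q)
    (h1 : G ∣ A * p + B * q) (h2 : G ∣ A' * p + B' * q) : G ∣ B' * A - A' * B := by
  obtain ⟨u, v, huv⟩ := hpq
  have : B' * A - A' * B =
      (u * B' - v * A') * (A * p + B * q) + (v * A - u * B) * (A' * p + B' * q) := by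
    linear_combination -(B' * A - A' * B) * huv
  rw [this]
  exact dvd_add (h1.mul_left _) (h2.mul_left _)

/-! ### Degrees and leading coefficients -/

/-- `p` has degree at most `n`, and `a` is its coefficient in degree `n`. -/
def HasTop (p : ℝ[X]) (n : ℕ) (a : ℝ) : Prop := p.natDegree ≤ n ∧ p.coeff n = a

namespace HasTop

variable {p q : ℝ[X]} {n m : ℕ} {a b : ℝ}

lemma add (hp : HasTop p n a) (hq : HasTop q n b) : HasTop (p + q) n (a + b) :=
  ⟨(natDegree_add_le _ _).trans (max_le hp.1 hq.1), by rw [coeff_add, hp.2, hq.2]⟩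

lemma sub (hp : HasTop p n a) (hq : HasTop q n b) : HasTop (p - q) n (a - b) :=
  ⟨(natDegree_sub_le _ _).trans (max_le hp.1 hq.1), by rw [coeff_sub, hp.2, hq.2]⟩

lemma mul (hp : HasTop p n a) (hq : HasTop q m b) : HasTop (p * q) (n + m) (a * b) :=
  ⟨natDegree_mul_le_of_le hp.1 hq.1, by
    rw [coeff_mul_add_eq_of_natDegree_le hp.1 hq.1, hp.2, hq.2]⟩

lemma const (a : ℝ) : HasTop (C a) 0 a := ⟨(natDegree_C a).le, coeff_C_zero⟩

lemma C_mul (r : ℝ) (hp : HasTop p n a) : HasTop (C r * p) n (r * a) := by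
  simpa using (const r).mul hp

lemma sum {ι : Type*} {s : Finset ι} {f : ι → ℝ[X]} {g : ι → ℝ}
    (hf : ∀ i ∈ s, HasTop (f i) n (g i)) : HasTop (∑ i ∈ s, f i) n (∑ i ∈ s, g i) :=
  ⟨natDegree_sum_le_of_forall_le s f fun i hi => (hf i hi).1, by
    rw [finsetSum_coeff]; exact sum_congr rfl fun i hi => (hf i hi).2⟩

lemma of_lt (hp : HasTop p n a) (hnm : n < m) : HasTop p m 0 :=
  ⟨hp.1.trans hnm.le, coeff_eq_zero_of_natDegree_lt (hp.1.trans_lt hnm)⟩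

lemma of_monic (hp : p.Monic) (hn : p.natDegree = n) : HasTop p n 1 :=
  ⟨hn.le, by rw [← hn]; exact hp⟩

lemma X_sub_C (g : ℝ) : HasTop (X - C g) 1 1 := of_monic (monic_X_sub_C g) (natDegree_X_sub_C g)

lemma natDegree_eq (hp : HasTop p n a) (ha : a ≠ 0) : p.natDegree = n :=
  natDegree_eq_of_le_of_coeff_ne_zero hp.1 (by rwa [hp.2])

lemma X_mul_derivative (hp : HasTop p n a) : HasTop (X * derivative p) n (n * a) := by
  constructor
  · cases n with
    | zero =>
      have : derivative p = 0 := derivative_of_natDegree_zero (Nat.le_zero.1 hp.1)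
      simp [this]
    | succ n =>
      have h1 : (derivative p).natDegree ≤ n := (natDegree_derivative_le p).trans (by have := hp.1; lia)
      rw [add_comm]
      exact natDegree_mul_le_of_le natDegree_X_le h1
  · cases n with
    | zero => simp
    | succ n => rw [coeff_X_mul, coeff_derivative, hp.2]; push_cast; ring

lemma one_sub_X_sq_mul_derivative (hp : HasTop p n a) :
    HasTop ((1 - X ^ 2) * derivative p) (n + 1) (-(n * a)) := by
  have h1 : HasTop (derivative p) (n + 1) 0 := by
    refine ⟨(natDegree_derivative_le p).trans ?_, coeff_eq_zero_of_natDegree_lt ?_⟩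
    · have := hp.1
      lia
    · have := hp.1
      have := natDegree_derivative_le p
      lia
  have hX : HasTop (X : ℝ[X]) 1 1 := of_monic monic_X natDegree_X
  have h2 := h1.sub (add_comm 1 n ▸ hX.mul hp.X_mul_derivative)
  convert h2 using 1
  · ring
  · ring

lemma natDegree_eq_of_eq_mul {G φ : ℝ[X]} {k : ℕ} (hp : HasTop p n a) (ha : a ≠ 0) (hG : G.Monic)
    (hGn : G.natDegree = k) (h : p = G * φ) (hn : n = k + m) : φ.natDegree = m := by
  have hφ : φ ≠ 0 := by
    rintro rfl
    rw [mul_zero] at h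
    exact ha (by rw [← hp.2, h, coeff_zero])
  have hdeg := hp.natDegree_eq ha
  rw [h, hG.natDegree_mul' hφ] at hdeg
  lia

end HasTop

lemma hasTop_taylorPoly (k : ℕ) (c : ℝ) (f : ℝ[X]) :
    HasTop (taylorPoly k c f) k (taylorCoeff k c f) := by
  have hpow : ∀ ν, HasTop ((X - C c) ^ ν) ν 1 := fun ν =>
    .of_monic ((monic_X_sub_C c).pow ν) (by
      rw [natDegree_pow, natDegree_X_sub_C, mul_one])
  rw [taylorPoly_eq, sum_range_succ]
  have h1 : HasTop (∑ ν ∈ range k, C (taylorCoeff ν c f) * (X - C c) ^ ν) k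
      (∑ ν ∈ range k, 0) :=
    .sum fun ν hν => ((hpow ν).C_mul _).of_lt (mem_range.1 hν)
  simpa using h1.add ((hpow k).C_mul (taylorCoeff k c f))

section Degrees

variable {N : ℕ} {c : Fin N → ℝ} {dd : Fin N → ℕ} {e : ℕ}

lemma hasTop_rhoPoly : HasTop (rhoPoly c dd) (∑ j, (dd j + 1)) 1 := by
  have hmon : ∀ i ∈ univ, ((X - C (c i)) ^ (dd i + 1)).Monic :=
    fun i _ => (monic_X_sub_C _).pow _
  refine .of_monic (monic_prod_of_monic _ _ hmon) ?_
  rw [rhoPoly, natDegree_prod_of_monic _ _ hmon]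
  simp

lemma hasTop_rhoJK (he : ∑ j, (dd j + 1) = e + 1) (j : Fin N) {k : ℕ} (hk : k ≤ dd j) :
    HasTop (rhoJK c dd j k) (e - k) 1 := by
  have h := rhoPoly_eq_rhoJK_mul (c := c) j hk
  have hq : ((X - C (c j)) ^ (k + 1)).Monic := (monic_X_sub_C _).pow _
  have hmon : (rhoJK c dd j k).Monic :=
    ((monic_X_sub_C _).pow _).mul (monic_prod_of_monic _ _ fun i _ => (monic_X_sub_C _).pow _)
  refine .of_monic hmon ?_
  have hdeg := (hasTop_rhoPoly (c := c) (dd := dd)).natDegree_eq one_ne_zero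
  rw [h, hmon.natDegree_mul hq, natDegree_pow, natDegree_X_sub_C, mul_one, he] at hdeg
  lia

lemma hasTop_sum_taylorPoly (he : ∑ j, (dd j + 1) = e + 1) (w : Fin N → ℕ → ℝ) (f : ℝ[X]) :
    HasTop (∑ j : Fin N, ∑ k ∈ range (dd j + 1),
        C (w j k) * (taylorPoly k (c j) f * rhoJK c dd j k)) e
      (∑ j : Fin N, ∑ k ∈ range (dd j + 1), w j k * taylorCoeff k (c j) f) := by
  refine .sum fun j _ => .sum fun k hk => ?_
  have hk' : k ≤ dd j := Nat.lt_succ_iff.1 (mem_range.1 hk)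
  have hke : k ≤ e := by
    have := single_le_sum (f := fun j => dd j + 1) (fun _ _ => Nat.zero_le _) (mem_univ j)
    lia
  have h := ((hasTop_taylorPoly k (c j) f).mul (hasTop_rhoJK (c := c) he j hk')).C_mul (w j k)
  rwa [Nat.add_sub_cancel' hke, mul_one] at h

end Degrees

section StructureDegrees

variable {α β : ℝ} {A B : ℝ[X]} {e m : ℕ} {b : ℝ}

lemma hasTop_ahat (h : 2 * (m : ℝ) + α + β ≠ 0) : HasTop (ahat α β m) 1 (-m) := by
  have hX : HasTop (X : ℝ[X]) 1 1 := .of_monic monic_X natDegree_X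
  convert ((hX.C_mul (2 * (m : ℝ) + α + β)).add
    ((HasTop.const (β - α)).of_lt one_pos)).C_mul (-(m : ℝ) / (2 * (m : ℝ) + α + β)) using 1
  · rfl
  · generalize 2 * (m : ℝ) + α + β = t at *
    field_simp
    ring

lemma hasTop_chat (h : 2 * (m : ℝ) + α + β ≠ 0) : HasTop (chat α β m) 1 (m + α + β) := by
  have hX : HasTop (X : ℝ[X]) 1 1 := .of_monic monic_X natDegree_X
  convert ((hX.C_mul (2 * (m : ℝ) + α + β)).add
    ((HasTop.const (α - β)).of_lt one_pos)).C_mul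
      (((m : ℝ) + α + β) / (2 * (m : ℝ) + α + β)) using 1
  · rfl
  · generalize 2 * (m : ℝ) + α + β = t at *
    field_simp
    ring

lemma hasTop_first_structure (h : 2 * (m : ℝ) + α + β ≠ 0) (hA : HasTop A (e + 1) 1)
    (hB : HasTop B e b) :
    HasTop ((1 - X ^ 2) * derivative A + ahat α β m * A + C (dhat α β m) * B) (e + 2)
      (-(m + e + 1)) := by
  have h1 := hA.one_sub_X_sq_mul_derivative
  have h2 := (hasTop_ahat h).mul hA
  rw [add_comm] at h2
  convert (h1.add h2).add ((hB.C_mul (dhat α β m)).of_lt (show e < e + 2 by lia)) using 1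
  push_cast
  ring

lemma hasTop_second_structure (h : 2 * (m : ℝ) + α + β ≠ 0) (hA : HasTop A (e + 1) 1)
    (hB : HasTop B e b) :
    HasTop ((1 - X ^ 2) * derivative B + C (bhat α β m) * A + chat α β m * B) (e + 1)
      (bhat α β m + (m + α + β - e) * b) := by
  have h1 := hB.one_sub_X_sq_mul_derivative
  have h2 := (hasTop_chat h).mul hB
  rw [add_comm] at h2
  convert (h1.add (hA.C_mul (bhat α β m))).add h2 using 1
  ring

lemma hasTop_add_mul_X_sub_C {a : ℝ} (hA : HasTop A (e + 1) a) (hB : HasTop B e b) (r g : ℝ) :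
    HasTop (A + C r * B * (X - C g)) (e + 1) (a + r * b) := by
  simpa using hA.add ((hB.C_mul r).mul (HasTop.X_sub_C g))

end StructureDegrees

lemma structure_combination {α β : ℝ} {A B p q R : ℝ[X]} {m : ℕ}
    (h : A * p + B * q = R)
    (hp : (1 - X ^ 2) * derivative p = ahat α β m * p + C (bhat α β m) * q)
    (hq : (1 - X ^ 2) * derivative q = chat α β m * q + C (dhat α β m) * p) :
    ((1 - X ^ 2) * derivative A + ahat α β m * A + C (dhat α β m) * B) * p +
      ((1 - X ^ 2) * derivative B + C (bhat α β m) * A + chat α β m * B) * q =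
      (1 - X ^ 2) * derivative R := by
  rw [← h, derivative_add, derivative_mul, derivative_mul]
  linear_combination -A * hp - B * hq

lemma jacobi_one_eq {α β : ℝ} (hα : -1 < α) (hβ : -1 < β) {P : ℕ → ℝ[X]}
    (hPm : ∀ m, (P m).Monic) (hPd : ∀ m, (P m).natDegree = m)
    (hPo : jacobiFunctional hα hβ (P 1 * P 0) = 0) :
    P 1 = X - C ((β - α) / (α + β + 2)) := by
  have hP0 : P 0 = 1 := (hPm 0).natDegree_eq_zero.1 (hPd 0)
  have hP1 : P 1 = X + C ((P 1).coeff 0) := by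
    have h1 : (P 1).coeff 1 = 1 := (HasTop.of_monic (hPm 1) (hPd 1)).2
    have h2 := eq_X_add_C_of_natDegree_le_one (hPd 1).le
    rwa [h1, C_1, one_mul] at h2
  generalize (P 1).coeff 0 = a at hP1
  have hpos : 0 < jacobiFunctional hα hβ 1 := by
    have := integral_sq_pos_jacobiMeasure hα hβ (one_ne_zero (α := ℝ[X]))
    rwa [mul_one] at this
  have hpearson : jacobiFunctional hα hβ (C (β - α) - C (α + β + 2) * X) = 0 :=
    integral_pearson_jacobiMeasure hα hβ
  rw [hP0, mul_one] at hPo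
  have hcomb : C (β - α) - C (α + β + 2) * X =
      C (β - α + (α + β + 2) * a) * 1 - C (α + β + 2) * P 1 := by
    rw [hP1, C_add (a := β - α), C_mul]
    ring
  rw [hcomb, map_sub, map_C_mul, map_C_mul, hPo, mul_zero, sub_zero] at hpearson
  have hne : α + β + 2 ≠ 0 := by linarith
  have h0 := (mul_eq_zero.1 hpearson).resolve_right hpos.ne'
  have ha : a = -((β - α) / (α + β + 2)) := by
    field_simp
    linarith
  rw [hP1, ha, C_neg, ← sub_eq_add_neg]

lemma ne_zero_of_eq_neg_sub_mul {s δ r b : ℝ} {n d : ℕ} (hs : -2 < s) (hs1 : 1 + s ≠ 0)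
    (hdn : d + 1 ≤ n) (hr : 0 < r) (hb : 0 ≤ b) (hδ : δ = -((n + s - d) * (1 + r * b))) :
    δ ≠ 0 := by
  have h1 : (0 : ℝ) < 1 + r * b := by positivity
  have h2 : (n : ℝ) + s - d ≠ 0 := by
    rcases hdn.eq_or_lt with h | h
    · rw [← h]
      push_cast
      intro h0
      exact hs1 (by linarith)
    · have : (d : ℝ) + 1 + 1 ≤ n := by exact_mod_cast h
      intro h0
      linarith
  rw [hδ]
  exact neg_ne_zero.2 (mul_ne_zero h2 h1.ne')

theorem stmt14 (α β : ℝ) (hα : -1 < α) (hβ : -1 < β)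
    (N : ℕ) (hN : 1 ≤ N)
    (c : Fin N → ℝ) (hc : Function.Injective c) (hcout : ∀ j, c j ∉ Set.Ioo (-1 : ℝ) 1)
    (dd : Fin N → ℕ) (hdd : Monotone dd)
    (lam : Fin N → ℕ → ℝ) (hlam : ∀ j k, 0 ≤ lam j k) (hlamd : ∀ j, 0 < lam j (dd j))
    (d : ℕ) (hd : d = ∑ j, (dd j + 1))
    (P : ℕ → Polynomial ℝ) (hPm : ∀ m, (P m).Monic) (hPd : ∀ m, (P m).natDegree = m)
    (hPo : ∀ m l, m ≠ l → ∫ x, (P m).eval x * (P l).eval x ∂(jacobiMeasure α β) = 0)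
    (h : ℕ → ℝ) (hh : ∀ m, h m = ∫ x, ((P m).eval x) ^ 2 ∂(jacobiMeasure α β))
    (S : ℕ → Polynomial ℝ) (hSm : ∀ m, (S m).Monic) (hSd : ∀ m, (S m).natDegree = m)
    (hSo : ∀ m l, l < m → sobolevIP α β c dd lam (X ^ l) (S m) = 0)
    (A2 B2 : ℕ → Polynomial ℝ)
    (hA2 : ∀ m, 1 ≤ m → A2 m = rhoPoly c dd -
      ∑ j : Fin N, ∑ k ∈ Finset.range (dd j + 1),
        Polynomial.C ((Nat.factorial k : ℝ) * lam j k * (iterDeriv k (S m)).eval (c j) / h (m - 1)) *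
          (taylorPoly k (c j) (P (m - 1)) * rhoJK c dd j k))
    (hB2 : ∀ m, 1 ≤ m → B2 m =
      ∑ j : Fin N, ∑ k ∈ Finset.range (dd j + 1),
        Polynomial.C ((Nat.factorial k : ℝ) * lam j k * (iterDeriv k (S m)).eval (c j) / h (m - 1)) *
          (taylorPoly k (c j) (P m) * rhoJK c dd j k))
    (A3 B3 : ℕ → Polynomial ℝ)
    (hA3 : ∀ m, 1 ≤ m → A3 m = (1 - X ^ 2) * Polynomial.derivative (A2 m) +
      ahat α β m * A2 m + Polynomial.C (dhat α β m) * B2 m)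
    (hB3 : ∀ m, 1 ≤ m → B3 m = (1 - X ^ 2) * Polynomial.derivative (B2 m) +
      Polynomial.C (bhat α β m) * A2 m + chat α β m * B2 m)
    (hrec : ∀ m, 1 ≤ m → X * P m =
      P (m + 1) + Polynomial.C (gamma1 α β m) * P m + Polynomial.C (gamma2 α β m) * P (m - 1))
    (C2 D2 : ℕ → Polynomial ℝ)
    (hC2 : ∀ m, 2 ≤ m → C2 m = Polynomial.C (-(1 / gamma2 α β (m - 1))) * B2 (m - 1))
    (hD2 : ∀ m, 2 ≤ m → D2 m = A2 (m - 1) +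
      Polynomial.C (1 / gamma2 α β (m - 1)) * B2 (m - 1) * (X - Polynomial.C (gamma1 α β (m - 1))))
    (C3 D3 : ℕ → Polynomial ℝ)
    (hC3 : ∀ m, 2 ≤ m → C3 m = Polynomial.C (-(1 / gamma2 α β (m - 1))) * B3 (m - 1))
    (hD3 : ∀ m, 2 ≤ m → D3 m = A3 (m - 1) +
      Polynomial.C (1 / gamma2 α β (m - 1)) * B3 (m - 1) * (X - Polynomial.C (gamma1 α β (m - 1))))
    (n : ℕ) (hn : 2 ≤ n) :
    ((∏ j : Fin N, (X - Polynomial.C (c j)) ^ dd j) ∣ (B3 n * A2 n - A3 n * B2 n) ∧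
     (∏ j : Fin N, (X - Polynomial.C (c j)) ^ dd j) ∣ (B3 n * C2 n - A3 n * D2 n) ∧
     (∏ j : Fin N, (X - Polynomial.C (c j)) ^ dd j) ∣ (B2 n * C3 n - A2 n * D3 n)) ∧
    ∀ φ1 φ2 φ3 : Polynomial ℝ,
      B3 n * A2 n - A3 n * B2 n = (∏ j : Fin N, (X - Polynomial.C (c j)) ^ dd j) * φ1 →
      B3 n * C2 n - A3 n * D2 n = (∏ j : Fin N, (X - Polynomial.C (c j)) ^ dd j) * φ2 →
      B2 n * C3 n - A2 n * D3 n = (∏ j : Fin N, (X - Polynomial.C (c j)) ^ dd j) * φ3 →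
      d + 1 ≤ n →
      φ1.natDegree = d + N ∧ φ2.natDegree = d + N + 1 ∧ φ3.natDegree = d + N + 1 := by
  classical
  set L := jacobiFunctional hα hβ with hLdef
  have hL : ∀ p : ℝ[X], p ≠ 0 → 0 < L (p * p) := fun p hp => integral_sq_pos_jacobiMeasure hα hβ hp
  have hPo' : ∀ m l, m ≠ l → L (P m * P l) = 0 := fun m l hml => by
    simpa [hLdef, jacobiFunctional] using hPo m l hml
  have hh' : ∀ m, h m = L (P m * P m) := fun m => by
    simp [hh, hLdef, jacobiFunctional, sq]
  have hSo' : ∀ m l, l < m → sobolevFunctional L c dd lam (S m) (X ^ l) = 0 := fun m l hml => by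
    rw [← sobolevIP_eq]
    exact hSo m l hml
  have hhpos : ∀ m, 0 < h m := fun m => by
    rw [hh']
    exact hL _ (hPm m).ne_zero
  have hP0 : P 0 = 1 := (hPm 0).natDegree_eq_zero.1 (hPd 0)
  have hP1 := jacobi_one_eq hα hβ hPm hPd (hPo' 1 0 one_ne_zero)
  have hγ : ∀ m, 1 ≤ m → 0 < gamma2 α β m := by
    intro m hm
    obtain ⟨m, rfl⟩ := Nat.exists_eq_add_of_le' hm
    have := recurrence_coeff_mul_norm hPm hPd hPo' hrec m
    rw [← hh', ← hh'] at this
    exact pos_of_mul_pos_left (this ▸ hhpos (m + 1)) (hhpos m).le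
  have hs : 1 + α + β ≠ 0 := by
    intro hs
    have h1 := hγ 1 le_rfl
    rw [gamma2, Nat.cast_one, hs] at h1
    simp at h1
  obtain ⟨e, he⟩ : ∃ e, ∑ j, (dd j + 1) = e + 1 := by
    refine Nat.exists_eq_succ_of_ne_zero ?_
    rw [sum_add_distrib]
    simp
    lia
  rw [he] at hd
  have hconn : ∀ m, 1 ≤ m → A2 m * P m + B2 m * P (m - 1) = rhoPoly c dd * S m := by
    intro m hm
    obtain ⟨m, rfl⟩ := Nat.exists_eq_add_of_le' hm
    rw [hA2 _ hm, hB2 _ hm, rho_mul_sobolev hL hPm hPd hPo' hSm hSd hSo' hrec m,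
      Nat.add_sub_cancel, hh']
  have hstruct : ∀ m, 1 ≤ m → A3 m * P m + B3 m * P (m - 1) =
      (1 - X ^ 2) * derivative (rhoPoly c dd * S m) := by
    intro m hm
    obtain ⟨hp, hq⟩ := jacobi_structure hα hβ hs hP0 hP1 hrec (m - 1)
    rw [Nat.sub_add_cancel hm] at hp hq
    rw [hA3 _ hm, hB3 _ hm]
    exact structure_combination (hconn m hm) hp hq
  set G := ∏ j : Fin N, (X - C (c j)) ^ dd j with hG
  have hdvd : ∀ q, G ∣ rhoPoly c dd * q := fun q => (prod_pow_dvd_rhoPoly c dd).mul_right q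
  have hdvd' : ∀ q, G ∣ (1 - X ^ 2) * derivative (rhoPoly c dd * q) := fun q => by
    rw [derivative_mul]
    exact (((prod_pow_dvd_derivative_prod univ c dd).mul_right q).add (hdvd _)).mul_left _
  obtain ⟨p, rfl⟩ := Nat.exists_eq_add_of_le' hn
  have hshift : ∀ A B : ℝ[X], C (-(1 / gamma2 α β (p + 1))) * B * P (p + 2) +
      (A + C (1 / gamma2 α β (p + 1)) * B * (X - C (gamma1 α β (p + 1)))) * P (p + 1) =
      A * P (p + 1) + B * P p := by
    intro A B
    have hr := hrec (p + 1) (by lia)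
    rw [Nat.add_sub_cancel] at hr
    have hC : C (1 / gamma2 α β (p + 1)) * C (gamma2 α β (p + 1)) = 1 := by
      rw [← C_mul, one_div_mul_cancel (hγ _ (by lia)).ne', C_1]
    rw [C_neg]
    linear_combination C (1 / gamma2 α β (p + 1)) * B * hr + B * P p * hC
  have hcop : IsCoprime (P (p + 2)) (P (p + 1)) :=
    isCoprime_of_recurrence hP0 (fun m hm => (hγ m hm).ne') hrec (p + 1)
  have h2 : G ∣ A2 (p + 2) * P (p + 2) + B2 (p + 2) * P (p + 1) :=
    hconn (p + 2) (by lia) ▸ hdvd _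
  have h3 : G ∣ A3 (p + 2) * P (p + 2) + B3 (p + 2) * P (p + 1) :=
    hstruct (p + 2) (by lia) ▸ hdvd' _
  have h2' : G ∣ C2 (p + 2) * P (p + 2) + D2 (p + 2) * P (p + 1) := by
    rw [hC2 _ hn, hD2 _ hn]
    exact (hshift _ _).trans (hconn (p + 1) (by lia)) ▸ hdvd _
  have h3' : G ∣ C3 (p + 2) * P (p + 2) + D3 (p + 2) * P (p + 1) := by
    rw [hC3 _ hn, hD3 _ hn]
    exact (hshift _ _).trans (hstruct (p + 1) (by lia)) ▸ hdvd' _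
  refine ⟨⟨dvd_det_of_isCoprime hcop h2 h3, dvd_det_of_isCoprime hcop h2' h3,
    dvd_det_of_isCoprime hcop h3' h2⟩, ?_⟩
  intro φ1 φ2 φ3 hφ1 hφ2 hφ3 hdn
  have hGm : G.Monic := monic_prod_of_monic _ _ fun i _ => (monic_X_sub_C _).pow _
  have hGd : G.natDegree + N = d := by
    rw [hG, natDegree_prod_of_monic _ _ fun i _ => (monic_X_sub_C _).pow _, hd, ← he,
      sum_add_distrib]
    simp
  obtain ⟨b, hb, hB2t⟩ : ∃ b : ℕ → ℝ, (∀ m, 0 ≤ b m) ∧ ∀ m, 1 ≤ m → HasTop (B2 m) e (b m) := by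
    refine ⟨fun m => ∑ j : Fin N, ∑ k ∈ range (dd j + 1),
      k.factorial * lam j k * (iterDeriv k (S m)).eval (c j) / h (m - 1) *
        taylorCoeff k (c j) (P m), fun m => ?_,
      fun m hm => hB2 m hm ▸ hasTop_sum_taylorPoly he _ _⟩
    have hnn := div_nonneg (sobolev_discrete_nonneg hL hPm hPd hPo' hSm hSd hSo' hlam m)
      (hhpos (m - 1)).le
    rw [sum_div] at hnn
    refine hnn.trans_eq (sum_congr rfl fun j _ => ?_)
    rw [sum_div]
    exact sum_congr rfl fun k _ => (div_mul_eq_mul_div _ _ _).symm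
  have hA2t : ∀ m, 1 ≤ m → HasTop (A2 m) (e + 1) 1 := by
    intro m hm
    rw [hA2 m hm]
    have hρ : HasTop (rhoPoly c dd) (e + 1) 1 := he ▸ hasTop_rhoPoly
    have hsub := hρ.sub ((hasTop_sum_taylorPoly (c := c) he
      (fun j k => k.factorial * lam j k * (iterDeriv k (S m)).eval (c j) / h (m - 1))
      (P (m - 1))).of_lt (Nat.lt_succ_self e))
    rwa [sub_zero] at hsub
  have hne : ∀ m : ℕ, 1 ≤ m → 2 * (m : ℝ) + α + β ≠ 0 := fun m hm =>
    (two_mul_add_pos hα hβ hm).ne'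
  have hA3t : ∀ m, 1 ≤ m → HasTop (A3 m) (e + 2) (-(m + e + 1)) := fun m hm =>
    hA3 m hm ▸ hasTop_first_structure (hne m hm) (hA2t m hm) (hB2t m hm)
  have hB3t : ∀ m, 1 ≤ m →
      HasTop (B3 m) (e + 1) ((2 * m + α + β + 1) * gamma2 α β m + (m + α + β - e) * b m) :=
    fun m hm => by
      rw [hB3 m hm, ← bhat_eq_mul_gamma2 hα hβ hs hm]
      exact hasTop_second_structure (hne m hm) (hA2t m hm) (hB2t m hm)
  have hγ1 := hγ (p + 1) (by lia)
  have hγ2 := hγ (p + 2) (by lia)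
  have hb1 := hb (p + 1)
  have hb2 := hb (p + 2)
  have hp1 : 1 ≤ p + 1 := by lia
  have hp2 : 1 ≤ p + 2 := by lia
  have hC2t : HasTop (C2 (p + 2)) e (-(1 / gamma2 α β (p + 1)) * b (p + 1)) :=
    hC2 _ hn ▸ (hB2t _ hp1).C_mul _
  have hD2t : HasTop (D2 (p + 2)) (e + 1) (1 + 1 / gamma2 α β (p + 1) * b (p + 1)) :=
    hD2 _ hn ▸ hasTop_add_mul_X_sub_C (hA2t _ hp1) (hB2t _ hp1) _ _
  have hC3t := (hB3t _ hp1).C_mul (-(1 / gamma2 α β (p + 1)))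
  have hD3t := hasTop_add_mul_X_sub_C (hA3t _ hp1) (hB3t _ hp1) (1 / gamma2 α β (p + 1))
    (gamma1 α β (p + 1))
  have hC3' : C3 (p + 2) = _ := hC3 _ hn
  have hD3' : D3 (p + 2) = _ := hD3 _ hn
  rw [Nat.add_sub_cancel_right (p + 1) 1] at hC3' hD3'
  rw [← hC3'] at hC3t
  rw [← hD3'] at hD3t
  have hpos : 0 < 2 * ((p + 2 : ℕ) : ℝ) + α + β := two_mul_add_pos hα hβ hp2
  refine ⟨?_, ?_, ?_⟩
  · have h11 := (hB3t _ hp2).mul (hA2t _ hp2)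
    have h12 := (hA3t _ hp2).mul (hB2t _ hp2)
    rw [show e + 2 + e = e + 1 + (e + 1) by lia] at h12
    refine (h11.sub h12).natDegree_eq_of_eq_mul ?_ hGm rfl hφ1 (by lia)
    have : 0 < (2 * ((p + 2 : ℕ) : ℝ) + α + β + 1) * (gamma2 α β (p + 2) + b (p + 2)) := by
      positivity
    refine ne_of_gt (this.trans_eq ?_)
    ring
  · have h21 := ((hB3t _ hp2).mul hC2t).of_lt (show e + 1 + e < e + 2 + (e + 1) by lia)
    refine (h21.sub ((hA3t _ hp2).mul hD2t)).natDegree_eq_of_eq_mul ?_ hGm rfl hφ2 (by lia)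
    have : 0 < (((p + 2 : ℕ) : ℝ) + e + 1) * (1 + 1 / gamma2 α β (p + 1) * b (p + 1)) := by
      positivity
    refine ne_of_gt (this.trans_eq ?_)
    ring
  · have h31 := ((hB2t _ hp2).mul hC3t).of_lt (show e + (e + 1) < e + 1 + (e + 2) by lia)
    refine (h31.sub ((hA2t _ hp2).mul hD3t)).natDegree_eq_of_eq_mul ?_ hGm rfl hφ3 (by lia)
    refine ne_zero_of_eq_neg_sub_mul (s := α + β) (by linarith) (by rwa [← add_assoc]) hdn
      (one_div_pos.2 hγ1) hb1 ?_
    rw [hd]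
    field_simp
    push_cast
    ring
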